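/- There exists n_0 such that for all integers n ≥ n_0, R(Q_n, Q_n) > 2.02·n. -/

import Mathlib

open Finset

/-- The poset Ramsey number `R(P,Q)`: the least `N` such that every blue/red coloring of the
Boolean lattice `Q_N` (subsets of `Fin N` ordered by inclusion, colors as `Bool` with
`true` = blue, `false` = red) contains a blue induced copy of `P` or a red induced copy of `Q`,
where an induced copy is the image of an order embedding. -/
noncomputable def posetRamsey (P : Type*) (Q : Type*) [PartialOrder P] [PartialOrder Q] : ℕ :=
  sInf {N : ℕ | ∀ c : Finset (Fin N) → Bool,
    (∃ e : P ↪o Finset (Fin N), ∀ p, c (e p) = true) ∨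
    (∃ e : Q ↪o Finset (Fin N), ∀ q, c (e q) = false)}

section Counting

variable {α ι : Type*} [Fintype α] [DecidableEq α]

/-- Among the two-colorings in which every block of a disjoint family meets the color `κ`,
each further block of size at most `q` costs a factor `1 - 2⁻ᵠ`. -/
lemma card_colorings_meeting_blocks_le (q : ℕ) (B : ι → Finset α) (κ : Bool) (J : Finset ι)
    (hd : (J : Set ι).PairwiseDisjoint B) (hq : ∀ i ∈ J, #(B i) ≤ q) :
    (#{c : α → Bool | ∀ i ∈ J, ∃ a ∈ B i, c a = κ} : ℝ) ≤
      (1 - (1 / 2 : ℝ) ^ q) ^ #J * 2 ^ Fintype.card α := by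
  classical
  induction J using Finset.induction_on with
  | empty => simp
  | insert j J hj ih =>
    specialize ih (hd.subset (by simp)) fun i hi => hq i (mem_insert_of_mem hi)
    set s : Finset (α → Bool) := {c | ∀ i ∈ J, ∃ a ∈ B i, c a = κ} with hs
    set t : Finset (α → Bool) := {c ∈ s | ∀ a ∈ B j, c a = !κ} with ht
    have hst : ({c : α → Bool | ∀ i ∈ insert j J, ∃ a ∈ B i, c a = κ} : Finset _) = s \ t := by
      ext c
      simp only [hs, ht, mem_filter, mem_univ, true_and, mem_sdiff, forall_mem_insert, not_and,
        not_forall]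
      constructor
      · rintro ⟨⟨a, ha, hc⟩, h⟩
        exact ⟨h, fun _ => ⟨a, ha, by simp [hc]⟩⟩
      · rintro ⟨h, h'⟩
        obtain ⟨a, ha, hc⟩ := h' h
        exact ⟨⟨a, ha, by simpa using hc⟩, h⟩
    have hdisj : ∀ i ∈ J, Disjoint (B i) (B j) := fun i hi =>
      hd (by simp [hi]) (by simp) (fun h => hj (h ▸ hi))
    have hle : #s ≤ 2 ^ q * #t := by
      refine card_le_mul_card_image_of_maps_to
        (f := fun c a => if a ∈ B j then !κ else c a) ?_ _ ?_
      · intro c hc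
        simp only [hs, ht, mem_filter, mem_univ, true_and] at hc ⊢
        refine ⟨fun i hi => ?_, fun a ha => by simp [ha]⟩
        obtain ⟨a, ha, hca⟩ := hc i hi
        exact ⟨a, ha, by simpa [disjoint_left.1 (hdisj i hi) ha] using hca⟩
      · intro b _
        calc #{c ∈ s | (fun a => if a ∈ B j then !κ else c a) = b}
            ≤ #(univ : Finset (B j → Bool)) := by
              refine card_le_card_of_injOn (fun c a => c a) (by simp) ?_
              intro c hc c' hc' h
              simp only [coe_filter, Set.mem_ofPred_eq] at hc hc'
              funext a
              by_cases ha : a ∈ B j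
              · exact congrFun h ⟨a, ha⟩
              · have := congrFun (hc.2.trans hc'.2.symm) a
                simpa [ha] using this
          _ = 2 ^ #(B j) := by simp
          _ ≤ 2 ^ q := Nat.pow_le_pow_right two_pos (hq j (by simp))
    have hle' : (#s : ℝ) ≤ 2 ^ q * #t := by exact_mod_cast hle
    have hmul : (1 / 2 : ℝ) ^ q * #s ≤ #t := by
      rw [one_div, inv_pow, inv_mul_le_iff₀ (by positivity)]
      exact hle'
    have h1 : (0 : ℝ) ≤ 1 - (1 / 2) ^ q :=
      sub_nonneg.2 (pow_le_one₀ (by norm_num) (by norm_num))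
    rw [hst, cast_card_sdiff (filter_subset _ _), card_insert_of_notMem hj, pow_succ']
    calc (#s : ℝ) - #t ≤ (1 - (1 / 2) ^ q) * #s := by linarith
      _ ≤ _ := by rw [mul_assoc]; exact mul_le_mul_of_nonneg_left ih h1

/-- Version of `card_colorings_meeting_blocks_le` where the family of blocks may depend on the
colors outside of all blocks. -/
lemma card_colorings_meeting_adaptive_blocks_le (q M : ℕ) (B : ι → Finset α) (κ : Bool)
    (I : Finset ι) (hd : (I : Set ι).PairwiseDisjoint B) (hq : ∀ i ∈ I, #(B i) ≤ q)
    (J : (α → Bool) → Finset ι) (hJI : ∀ c, J c ⊆ I)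
    (hJ : ∀ c c' : α → Bool, (∀ a, (∀ i ∈ I, a ∉ B i) → c a = c' a) → J c = J c') :
    (#{c : α → Bool | M ≤ #(J c) ∧ ∀ i ∈ J c, ∃ a ∈ B i, c a = κ} : ℝ) ≤
      (1 - (1 / 2 : ℝ) ^ q) ^ M * 2 ^ Fintype.card α := by
  classical
  have h0 : (0 : ℝ) ≤ 1 - (1 / 2) ^ q :=
    sub_nonneg.2 (pow_le_one₀ (by norm_num) (by norm_num))
  have h1 : (1 : ℝ) - (1 / 2) ^ q ≤ 1 := sub_le_self _ (by positivity)
  set bad : Finset (α → Bool) := {c | M ≤ #(J c) ∧ ∀ i ∈ J c, ∃ a ∈ B i, c a = κ} with hbad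
  let mix : (α → Bool) → (α → Bool) → α → Bool :=
    fun c r a => if ∃ i ∈ I, a ∈ B i then r a else c a
  have hmix : Function.Involutive
      fun p : (α → Bool) × (α → Bool) => (mix p.1 p.2, mix p.2 p.1) := by
    rintro ⟨c, r⟩
    ext a <;> by_cases ha : ∃ i ∈ I, a ∈ B i <;> simp [mix, ha]
  have hcount : #bad * 2 ^ Fintype.card α = ∑ c : α → Bool, #{r : α → Bool | mix c r ∈ bad} := by
    calc #bad * 2 ^ Fintype.card α = #(bad ×ˢ (univ : Finset (α → Bool))) := by simp
      _ = #{p : (α → Bool) × (α → Bool) | mix p.1 p.2 ∈ bad} := by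
        refine card_bij' (fun p _ => (mix p.1 p.2, mix p.2 p.1))
          (fun p _ => (mix p.1 p.2, mix p.2 p.1)) ?_ ?_ (fun p _ => hmix p) (fun p _ => hmix p)
        · intro p hp
          have h : mix (mix p.1 p.2) (mix p.2 p.1) = p.1 := congrArg Prod.fst (hmix p)
          simp only [mem_product, mem_univ, and_true] at hp
          simpa [h] using hp
        · intro p hp
          simpa using hp
      _ = ∑ c : α → Bool, #{r : α → Bool | mix c r ∈ bad} := by
        simp only [card_filter, ← univ_product_univ, sum_product]
  have hfib : ∀ c : α → Bool, (#{r : α → Bool | mix c r ∈ bad} : ℝ) ≤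
      (1 - (1 / 2 : ℝ) ^ q) ^ M * 2 ^ Fintype.card α := by
    intro c
    have hJc : ∀ r, J (mix c r) = J c := fun r => hJ _ _ fun a ha => by
      have : ¬ ∃ i ∈ I, a ∈ B i := by simpa using ha
      simp [mix, this]
    by_cases hM : M ≤ #(J c)
    · refine le_trans ?_ ((card_colorings_meeting_blocks_le q B κ (J c)
        (hd.subset (by exact_mod_cast hJI c)) fun i hi => hq i (hJI c hi)).trans
        (mul_le_mul_of_nonneg_right (pow_le_pow_of_le_one h0 h1 hM) (by positivity)))
      norm_cast
      refine card_le_card fun r hr => ?_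
      simp only [hbad, mem_filter, mem_univ, true_and, hJc] at hr ⊢
      intro i hi
      obtain ⟨a, ha, h⟩ := hr.2 i hi
      have : ∃ i ∈ I, a ∈ B i := ⟨i, hJI c hi, ha⟩
      exact ⟨a, ha, by simpa [mix, this] using h⟩
    · have : ({r : α → Bool | mix c r ∈ bad} : Finset _) = ∅ := by
        ext r
        simp [hbad, hJc, hM]
      rw [this, card_empty, Nat.cast_zero]
      exact mul_nonneg (pow_nonneg h0 _) (by positivity)
  have hsum : (#bad : ℝ) * 2 ^ Fintype.card α ≤
      ((1 - (1 / 2 : ℝ) ^ q) ^ M * 2 ^ Fintype.card α) * 2 ^ Fintype.card α := by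
    have : (#bad : ℝ) * 2 ^ Fintype.card α =
        ∑ c : α → Bool, (#{r : α → Bool | mix c r ∈ bad} : ℝ) := by exact_mod_cast hcount
    rw [this]
    refine (sum_le_sum fun c _ => hfib c).trans_eq ?_
    simp [mul_comm]
  exact le_of_mul_le_mul_right hsum (by positivity)

lemma card_filter_exists_le {Ω : Type*} [Fintype Ω] (p : Ω → α → Prop)
    [∀ ω, DecidablePred (p ω)] [DecidablePred fun a => ∃ ω, p ω a] {t : ℝ}
    (h : ∀ ω, (#{a | p ω a} : ℝ) ≤ t) : (#{a | ∃ ω, p ω a} : ℝ) ≤ Fintype.card Ω * t := by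
  have : ({a | ∃ ω, p ω a} : Finset α) = univ.biUnion fun ω => {a | p ω a} := by
    ext; simp
  rw [this]
  calc (#(univ.biUnion fun ω => ({a | p ω a} : Finset α)) : ℝ) ≤ ∑ ω, (#{a | p ω a} : ℝ) := by
        exact_mod_cast card_biUnion_le
    _ ≤ ∑ _ω : Ω, t := sum_le_sum fun ω _ => h ω
    _ = _ := by simp

lemma card_finsets_card_le (K : ℕ) :
    Fintype.card {S : Finset α // #S ≤ K} ≤ (Fintype.card α + 1) ^ K := by
  rw [Fintype.card_subtype]
  induction K with
  | zero => simp [filter_eq']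
  | succ K ih =>
    calc #{S : Finset α | #S ≤ K + 1}
        ≤ #((({S : Finset α | #S ≤ K} : Finset _) ×ˢ (univ : Finset (Option α))).image
            fun p => p.2.elim p.1 (insert · p.1)) := by
          refine card_le_card fun S hS => ?_
          simp only [mem_filter, mem_univ, true_and] at hS
          simp only [mem_image, mem_product, mem_filter, mem_univ, true_and, and_true, Prod.exists]
          rcases S.eq_empty_or_nonempty with rfl | ⟨a, ha⟩
          · exact ⟨∅, none, by simp⟩
          · refine ⟨S.erase a, some a, ?_, by simp [insert_erase ha]⟩
            rw [card_erase_of_mem ha]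
            omega
      _ ≤ #{S : Finset α | #S ≤ K} * (Fintype.card α + 1) := by
          refine card_image_le.trans_eq ?_
          simp
      _ ≤ _ := by
          rw [pow_succ]
          exact Nat.mul_le_mul_right _ ih

end Counting

section RandomColoring

variable {β : Type*} [Fintype β] [DecidableEq β]

/-- The points `x ∈ V` such that every set between `Q ∪ {x}` and `Q ∪ {x} ∪ D` avoids the
color `κ`. -/
def blockedPoints (c : Finset β → Bool) (κ : Bool) (Q D V : Finset β) : Finset β :=
  {x ∈ V | ∀ S ∈ D.powerset, c (insert x (Q ∪ S)) ≠ κ}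

/-- Each `b` in a large set `V₀`, after enlarging `P ∪ {b}` by a small set `g b`, has few blocked
points in the large set `V₁`. -/
def HasSparseFan (c : Finset β → Bool) (κ : Bool) (m M : ℕ) : Prop :=
  ∃ P V₀ V₁ : Finset β, ∃ g D : β → {S : Finset β // #S ≤ 5},
    Disjoint V₀ V₁ ∧ (∀ b ∈ V₀, Disjoint (P ∪ g b ∪ D b) (V₀ ∪ V₁)) ∧ m ≤ #V₀ ∧ m ≤ #V₁ ∧
    ∀ b ∈ V₀, #(blockedPoints c κ (insert b (P ∪ g b)) (D b) V₁) ≤ M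

/-- There are many pairs of blocked points, but none of these pairs is blocked itself. -/
def HasUnblockedPairs (c : Finset β → Bool) (κ : Bool) (M : ℕ) : Prop :=
  ∃ Q V₁ V₂ : Finset β, ∃ (g : β → {S : Finset β // #S ≤ 5}) (D : {S : Finset β // #S ≤ 5}),
    Disjoint V₁ V₂ ∧ Disjoint (Q ∪ D) (V₁ ∪ V₂) ∧
    (∀ x ∈ V₁ ∪ V₂, Disjoint (g x : Finset β) (V₁ ∪ V₂)) ∧
    M ≤ #(blockedPoints c κ Q D V₁) ∧ (∀ x ∈ V₁, M ≤ #(blockedPoints c κ Q (D ∪ g x) V₂)) ∧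
    ∀ x ∈ blockedPoints c κ Q D V₁, ∀ x' ∈ blockedPoints c κ Q (D ∪ g x) V₂,
      ∃ S ∈ (D : Finset β).powerset, c (insert x (insert x' (Q ∪ g x ∪ g x' ∪ S))) = κ

lemma card_image_powerset_le {α γ : Type*} [DecidableEq γ] (D : {S : Finset α // #S ≤ 5})
    (f : Finset α → γ) : #((D : Finset α).powerset.image f) ≤ 32 := by
  refine card_image_le.trans ?_
  rw [card_powerset]
  exact Nat.pow_le_pow_right two_pos D.2

open Classical in
lemma card_hasSparseFan_le (κ : Bool) {m M : ℕ} :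
    (#{c : Finset β → Bool | HasSparseFan c κ m M} : ℝ) ≤
      (2 ^ (3 * Fintype.card β) * (Fintype.card β + 1) ^ ((10 + M) * Fintype.card β) : ℕ) *
        ((1 - (1 / 2 : ℝ) ^ 32) ^ (m * (m - M)) * 2 ^ Fintype.card (Finset β)) := by
  set t : ℝ := (1 - (1 / 2 : ℝ) ^ 32) ^ (m * (m - M)) * 2 ^ Fintype.card (Finset β)
  have ht0 : 0 ≤ t := mul_nonneg (pow_nonneg (by norm_num) _) (by positivity)
  let Ω := Finset β × Finset β × Finset β × (β → {S : Finset β // #S ≤ 5}) ×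
    (β → {S : Finset β // #S ≤ 5}) × (β → {S : Finset β // #S ≤ M})
  let p : Ω → (Finset β → Bool) → Prop := fun ⟨P, V₀, V₁, g, D, G⟩ c =>
    Disjoint V₀ V₁ ∧ (∀ b ∈ V₀, Disjoint (P ∪ g b ∪ D b) (V₀ ∪ V₁)) ∧ m ≤ #V₀ ∧ m ≤ #V₁ ∧
      ∀ i ∈ V₀.sigma fun b => V₁ \ G b,
        ∃ Z ∈ (D i.1 : Finset β).powerset.image
          (fun S => insert i.2 (insert i.1 (P ∪ g i.1) ∪ S)), c Z = κ
  have hΩ : Fintype.card Ω ≤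
      2 ^ (3 * Fintype.card β) * (Fintype.card β + 1) ^ ((10 + M) * Fintype.card β) := by
    have h5 := Nat.pow_le_pow_left (card_finsets_card_le (α := β) 5) (Fintype.card β)
    have hM := Nat.pow_le_pow_left (card_finsets_card_le (α := β) M) (Fintype.card β)
    simp only [Ω, Fintype.card_prod, Fintype.card_fun, Fintype.card_finset]
    calc _ ≤ 2 ^ Fintype.card β * (2 ^ Fintype.card β * (2 ^ Fintype.card β *
          (((Fintype.card β + 1) ^ 5) ^ Fintype.card β *
          (((Fintype.card β + 1) ^ 5) ^ Fintype.card β *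
            ((Fintype.card β + 1) ^ M) ^ Fintype.card β)))) := by gcongr
      _ = _ := by generalize Fintype.card β + 1 = q; ring
  have hp : ∀ ω, (#{c | p ω c} : ℝ) ≤ t := by
    rintro ⟨P, V₀, V₁, g, D, G⟩
    by_cases hω : Disjoint V₀ V₁ ∧ (∀ b ∈ V₀, Disjoint (P ∪ g b ∪ D b) (V₀ ∪ V₁)) ∧
      m ≤ #V₀ ∧ m ≤ #V₁
    · obtain ⟨h01, hdis, hV₀, hV₁⟩ := hω
      set I : Finset (Σ _ : β, β) := V₀.sigma fun b => V₁ \ G b with hI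
      have hIcard : m * (m - M) ≤ #I := by
        rw [hI, card_sigma]
        calc m * (m - M) ≤ #V₀ * (m - M) := Nat.mul_le_mul_right _ hV₀
          _ = ∑ _b ∈ V₀, (m - M) := by simp
          _ ≤ ∑ b ∈ V₀, #(V₁ \ G b) := sum_le_sum fun b _ => by
            have := le_card_sdiff (G b : Finset β) V₁
            have := (G b).2
            omega
      have key := card_colorings_meeting_blocks_le 32
        (fun i : Σ _ : β, β => (D i.1 : Finset β).powerset.image
          (fun S => insert i.2 (insert i.1 (P ∪ g i.1) ∪ S))) κ I ?_ ?_
      · refine le_trans ?_ (key.trans (mul_le_mul_of_nonneg_right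
          (pow_le_pow_of_le_one (by norm_num) (by norm_num) hIcard) (by positivity)))
        norm_cast
        exact card_le_card fun c hc => by
          simp only [p, mem_filter, mem_univ, true_and] at hc ⊢
          exact hc.2.2.2.2
      · rintro ⟨b, x⟩ hbx ⟨b', x'⟩ hbx' hne
        simp only [hI, coe_sigma, Set.mem_sigma_iff, mem_coe, mem_sdiff] at hbx hbx'
        refine disjoint_left.2 fun Z hZ hZ' => hne ?_
        simp only [mem_image, mem_powerset] at hZ hZ'
        obtain ⟨S, hS, rfl⟩ := hZ
        obtain ⟨S', hS', h⟩ := hZ'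
        have hb := hdis b hbx.1
        have hb' : b ∈ insert x' (insert b' (P ∪ g b') ∪ S') := h ▸ by simp
        have hx' : x ∈ insert x' (insert b' (P ∪ g b') ∪ S') := h ▸ by simp
        have hnot : ∀ y ∈ V₀ ∪ V₁, y ∉ P ∧ y ∉ (g b' : Finset β) ∧ y ∉ S' := fun y hy => by
          have := disjoint_right.1 (hdis b' hbx'.1) hy
          simp only [mem_union, not_or] at this
          exact ⟨this.1.1, this.1.2, fun h => this.2 (hS' h)⟩
        have e1 := hnot b (by simp [hbx.1])
        have e2 := hnot x (by simp [hbx.2.1])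
        have n1 : b ≠ x' := fun h => disjoint_left.1 h01 hbx.1 (h ▸ hbx'.2.1)
        have n2 : x ≠ b' := fun h => disjoint_left.1 h01 hbx'.1 (h ▸ hbx.2.1)
        have f1 : b = b' := by simpa [e1, n1] using hb'
        have f2 : x = x' := by simpa [e2, n2] using hx'
        rw [f1, f2]
      · exact fun i _ => card_image_powerset_le _ _
    · have : ({c | p (P, V₀, V₁, g, D, G) c} : Finset (Finset β → Bool)) = ∅ := by
        ext c
        simp only [p, mem_filter, mem_univ, true_and, notMem_empty, iff_false]
        exact fun h => hω ⟨h.1, h.2.1, h.2.2.1, h.2.2.2.1⟩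
      rw [this]
      simpa using ht0
  calc (#{c : Finset β → Bool | HasSparseFan c κ m M} : ℝ) ≤ #{c | ∃ ω, p ω c} := by
        norm_cast
        refine card_le_card fun c hc => ?_
        simp only [mem_filter, mem_univ, true_and] at hc ⊢
        obtain ⟨P, V₀, V₁, g, D, h01, hdis, hV₀, hV₁, h⟩ := hc
        have : ∀ b, ∃ G : {S : Finset β // #S ≤ M}, b ∈ V₀ →
            (G : Finset β) = blockedPoints c κ (insert b (P ∪ g b)) (D b) V₁ := fun b => by
          by_cases hb : b ∈ V₀
          · exact ⟨⟨_, h b hb⟩, fun _ => rfl⟩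
          · exact ⟨⟨∅, by simp⟩, fun h => absurd h hb⟩
        choose G hG using this
        refine ⟨(P, V₀, V₁, g, D, G), h01, hdis, hV₀, hV₁, ?_⟩
        rintro ⟨b, x⟩ hbx
        simp only [mem_sigma, mem_sdiff] at hbx
        obtain ⟨hb, hx, hxG⟩ := hbx
        rw [hG b hb, blockedPoints, mem_filter] at hxG
        push Not at hxG
        obtain ⟨S, hS, hc⟩ := hxG hx
        exact ⟨_, mem_image_of_mem _ hS, hc⟩
    _ ≤ Fintype.card Ω * t := card_filter_exists_le p hp
    _ ≤ _ := mul_le_mul_of_nonneg_right (by exact_mod_cast hΩ) ht0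

open Classical in
lemma card_hasUnblockedPairs_le (κ : Bool) {M : ℕ} :
    (#{c : Finset β → Bool | HasUnblockedPairs c κ M} : ℝ) ≤
      (2 ^ (3 * Fintype.card β) * (Fintype.card β + 1) ^ (5 * Fintype.card β + 5) : ℕ) *
        ((1 - (1 / 2 : ℝ) ^ 32) ^ (M * M) * 2 ^ Fintype.card (Finset β)) := by
  set t : ℝ := (1 - (1 / 2 : ℝ) ^ 32) ^ (M * M) * 2 ^ Fintype.card (Finset β)
  have ht0 : 0 ≤ t := mul_nonneg (pow_nonneg (by norm_num) _) (by positivity)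
  let Ω := Finset β × Finset β × Finset β × (β → {S : Finset β // #S ≤ 5}) ×
    {S : Finset β // #S ≤ 5}
  let valid : Ω → Prop := fun ⟨Q, V₁, V₂, g, D⟩ =>
    Disjoint V₁ V₂ ∧ Disjoint (Q ∪ D) (V₁ ∪ V₂) ∧
      ∀ x ∈ V₁ ∪ V₂, Disjoint (g x : Finset β) (V₁ ∪ V₂)
  let J : Ω → (Finset β → Bool) → Finset (Σ _ : β, β) := fun ⟨Q, V₁, V₂, g, D⟩ c =>
    (blockedPoints c κ Q D V₁).sigma fun x => blockedPoints c κ Q (D ∪ g x) V₂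
  let B : Ω → (Σ _ : β, β) → Finset (Finset β) := fun ⟨Q, V₁, V₂, g, D⟩ i =>
    (D : Finset β).powerset.image
      fun S => insert i.1 (insert i.2 (Q ∪ g i.1 ∪ g i.2 ∪ S))
  let p : Ω → (Finset β → Bool) → Prop := fun ω c =>
    valid ω ∧ M * M ≤ #(J ω c) ∧ ∀ i ∈ J ω c, ∃ Z ∈ B ω i, c Z = κ
  have hΩ : Fintype.card Ω ≤
      2 ^ (3 * Fintype.card β) * (Fintype.card β + 1) ^ (5 * Fintype.card β + 5) := by
    have h5 := card_finsets_card_le (α := β) 5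
    have h5' := Nat.pow_le_pow_left h5 (Fintype.card β)
    simp only [Ω, Fintype.card_prod, Fintype.card_fun, Fintype.card_finset]
    calc _ ≤ 2 ^ Fintype.card β * (2 ^ Fintype.card β * (2 ^ Fintype.card β *
          (((Fintype.card β + 1) ^ 5) ^ Fintype.card β * (Fintype.card β + 1) ^ 5))) := by gcongr
      _ = _ := by generalize Fintype.card β + 1 = q; ring
  have hp : ∀ ω, (#{c | p ω c} : ℝ) ≤ t := by
    rintro ⟨Q, V₁, V₂, g, D⟩
    by_cases hω : valid (Q, V₁, V₂, g, D)
    · obtain ⟨h12, hQD, hg⟩ := hω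
      have hcell : ∀ i ∈ V₁.sigma fun _ => V₂, ∀ Z ∈ B (Q, V₁, V₂, g, D) i, ∀ y ∈ V₁ ∪ V₂,
          y ∈ Z ↔ y = i.1 ∨ y = i.2 := by
        rintro ⟨x, x'⟩ hi Z hZ y hy
        simp only [mem_sigma] at hi
        simp only [B, mem_image, mem_powerset] at hZ
        obtain ⟨S, hS, rfl⟩ := hZ
        have h1 := disjoint_right.1 hQD hy
        have h2 := disjoint_right.1 (hg x (by simp [hi.1])) hy
        have h3 := disjoint_right.1 (hg x' (by simp [hi.2])) hy
        simp only [mem_union, not_or] at h1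
        have h4 : y ∉ S := fun h => h1.2 (hS h)
        simp [h1.1, h2, h3, h4]
      refine le_trans ?_ (card_colorings_meeting_adaptive_blocks_le 32 (M * M)
        (B (Q, V₁, V₂, g, D)) κ (V₁.sigma fun _ => V₂) ?_ ?_ (J (Q, V₁, V₂, g, D)) ?_ ?_)
      · norm_cast
        exact card_le_card fun c hc => by
          simp only [p, mem_filter, mem_univ, true_and] at hc ⊢
          exact hc.2
      · rintro ⟨x, x'⟩ hi ⟨z, z'⟩ hj hne
        refine disjoint_left.2 fun Z hZ hZ' => hne ?_
        have e := hcell _ hi Z hZ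
        have e' := hcell _ hj Z hZ'
        simp only [coe_sigma, Set.mem_sigma_iff, mem_coe] at hi hj
        have f1 := (e' x (by simp [hi.1])).1 ((e x (by simp [hi.1])).2 (Or.inl rfl))
        have f2 := (e' x' (by simp [hi.2])).1 ((e x' (by simp [hi.2])).2 (Or.inr rfl))
        have n1 : x ≠ z' := fun h => disjoint_left.1 h12 hi.1 (h ▸ hj.2)
        have n2 : x' ≠ z := fun h => disjoint_left.1 h12 hj.1 (h ▸ hi.2)
        rw [f1.resolve_right n1, f2.resolve_left n2]
      · exact fun i _ => card_image_powerset_le _ _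
      · exact fun c => sigma_mono (filter_subset _ _) fun _ => filter_subset _ _
      · intro c c' hcc
        have hdisj : ∀ y ∈ V₁ ∪ V₂, y ∉ Q ∧ y ∉ (D : Finset β) := fun y hy => by
          simpa using disjoint_right.1 hQD hy
        have h1 : blockedPoints c κ Q D V₁ = blockedPoints c' κ Q D V₁ := by
          refine filter_congr fun x hx => forall₂_congr fun S hS => ?_
          rw [hcc]
          intro i hi hZ
          have hi2 := (mem_sigma.1 hi).2
          have := (hcell i hi _ hZ i.2 (by simp [hi2])).2 (Or.inr rfl)
          have hy := hdisj i.2 (by simp [hi2])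
          have hyS : i.2 ∉ S := fun h => hy.2 (mem_powerset.1 hS h)
          have hyx : i.2 = x := by simpa [hy.1, hyS] using this
          exact disjoint_left.1 h12 hx (hyx ▸ hi2)
        have h2 : ∀ x ∈ V₁, blockedPoints c κ Q (D ∪ g x) V₂ =
            blockedPoints c' κ Q (D ∪ g x) V₂ := fun z hz => by
          refine filter_congr fun x hx => forall₂_congr fun S hS => ?_
          rw [hcc]
          intro i hi hZ
          have hi1 := (mem_sigma.1 hi).1
          have := (hcell i hi _ hZ i.1 (by simp [hi1])).2 (Or.inl rfl)
          have hy := hdisj i.1 (by simp [hi1])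
          have hyg := disjoint_right.1 (hg z (by simp [hz])) (mem_union_left V₂ hi1)
          have hyS : i.1 ∉ S := fun h => by
            have := mem_powerset.1 hS h
            simp [hy.2, hyg] at this
          have hyx : i.1 = x := by simpa [hy.1, hyS] using this
          exact disjoint_left.1 h12 hi1 (hyx ▸ hx)
        simp only [J, h1]
        ext ⟨x, x'⟩
        simp only [mem_sigma]
        refine and_congr_right fun hx => ?_
        rw [h2 x (mem_filter.1 hx).1]
    · have : ({c | p (Q, V₁, V₂, g, D) c} : Finset (Finset β → Bool)) = ∅ := by
        ext c
        simp only [p, mem_filter, mem_univ, true_and, notMem_empty, iff_false]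
        exact fun h => hω h.1
      rw [this]
      simpa using ht0
  calc (#{c : Finset β → Bool | HasUnblockedPairs c κ M} : ℝ) ≤ #{c | ∃ ω, p ω c} := by
        norm_cast
        refine card_le_card fun c hc => ?_
        simp only [mem_filter, mem_univ, true_and] at hc ⊢
        obtain ⟨Q, V₁, V₂, g, D, h12, hQD, hg, hM₁, hM₂, h⟩ := hc
        refine ⟨(Q, V₁, V₂, g, D), ⟨h12, hQD, hg⟩, ?_, ?_⟩
        · simp only [J, card_sigma]
          calc M * M ≤ #(blockedPoints c κ Q D V₁) * M := Nat.mul_le_mul_right _ hM₁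
            _ = ∑ _x ∈ blockedPoints c κ Q D V₁, M := by simp
            _ ≤ _ := sum_le_sum fun x hx => hM₂ x (mem_filter.1 hx).1
        · rintro ⟨x, x'⟩ hi
          simp only [J, mem_sigma] at hi
          obtain ⟨S, hS, hc⟩ := h x hi.1 x' hi.2
          exact ⟨_, mem_image_of_mem _ hS, hc⟩
    _ ≤ Fintype.card Ω * t := card_filter_exists_le p hp
    _ ≤ _ := mul_le_mul_of_nonneg_right (by exact_mod_cast hΩ) ht0

end RandomColoring

section Copies

variable {β : Type*} [DecidableEq β]

lemma card_add_three_le {s t u v w : Finset β} (h1 : ¬ t ⊆ s) (h2 : ¬ u ⊆ s ∪ t)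
    (h3 : ¬ v ⊆ t ∪ u ∪ s) (hs : s ⊆ w) (ht : t ⊆ w) (hu : u ⊆ w) (hv : v ⊆ w) :
    #s + 3 ≤ #w := by
  obtain ⟨a, hat, has⟩ := not_subset.1 h1
  obtain ⟨b, hbu, hb⟩ := not_subset.1 h2
  obtain ⟨d, hdv, hd⟩ := not_subset.1 h3
  have hb' : b ∉ insert a s := by
    simp only [mem_insert, mem_union, not_or] at hb ⊢
    exact ⟨fun h => hb.2 (h ▸ hat), hb.1⟩
  have hd' : d ∉ insert b (insert a s) := by
    simp only [mem_insert, mem_union, not_or] at hd ⊢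
    exact ⟨fun h => hd.1.2 (h ▸ hbu), fun h => hd.1.1 (h ▸ hat), hd.2⟩
  calc #s + 3 = #(insert d (insert b (insert a s))) := by
        rw [card_insert_of_notMem hd', card_insert_of_notMem hb', card_insert_of_notMem has]
    _ ≤ #w := card_le_card <| by
        simp only [insert_subset_iff]
        exact ⟨hv hdv, hu hbu, ht hat, hs⟩

/-- Every embedded Boolean lattice is the graph of a monotone map over some ground set `X`. -/
lemma exists_monotone_section {n : ℕ} (e : Finset (Fin n) ↪o Finset β) :
    ∃ (X : Finset β) (φ : Finset β → Finset β), #X = n ∧ Monotone φ ∧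
      (∀ T, φ T ∩ X = T ∩ X) ∧ ∀ T, φ T ∈ Set.range e := by
  have h : ∀ i : Fin n, ∃ a ∈ e {i}, a ∉ e (univ.erase i) := fun i => by
    refine not_subset.1 fun h => ?_
    have : ({i} : Finset (Fin n)) ⊆ univ.erase i := e.le_iff_le.1 h
    simp at this
  choose a ha ha' using h
  have hmem : ∀ A i, a i ∈ e A ↔ i ∈ A := fun A i => by
    constructor
    · intro h
      by_contra hi
      exact ha' i (e.monotone (subset_erase.2 ⟨subset_univ _, hi⟩) h)
    · exact fun h => e.monotone (singleton_subset_iff.2 h) (ha i)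
  have hinj : Function.Injective a := fun i j hij => by
    simpa using (hmem {j} i).1 (hij ▸ ha j)
  refine ⟨univ.image a, fun T => e {i | a i ∈ T}, ?_, ?_, ?_, fun T => ⟨_, rfl⟩⟩
  · rw [card_image_of_injective _ hinj, card_univ, Fintype.card_fin]
  · exact fun S T hST => e.monotone (monotone_filter_right _ fun i _ hi => hST hi)
  · intro T
    ext x
    simp only [mem_inter, mem_image, mem_univ, true_and, and_congr_left_iff]
    rintro ⟨i, rfl⟩
    simp [hmem]

set_option maxHeartbeats 400000 in
/-- If the coloring is typical, then a monochromatic monotone section grows by at least six outside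
of its ground set `X` over at most five suitable steps inside of `X`. -/
lemma exists_growing_step [Fintype β] {c : Finset β → Bool} {κ : Bool} {m M : ℕ}
    (hfan : ¬ HasSparseFan c κ m M) (hpairs : ¬ HasUnblockedPairs c κ M)
    {X : Finset β} {φ : Finset β → Finset β} (hφ : Monotone φ) (hX : ∀ T, φ T ∩ X = T ∩ X)
    (hc : ∀ T, c (φ T) = κ) {A : Finset β} (hA : A ⊆ X) (hm : 4 * m ≤ #(X \ A)) :
    ∃ T ⊆ X, #T ≤ #A + 5 ∧ #(φ A \ X) + 6 ≤ #(φ T \ X) := by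
  classical
  by_contra! hcon
  obtain ⟨V₀, hV₀, hV₀c⟩ := exists_subset_card_eq (show 2 * m ≤ #(X \ A) by omega)
  obtain ⟨V₁, hV₁, hV₁c⟩ := exists_subset_card_eq
    (show m ≤ #((X \ A) \ V₀) by rw [card_sdiff_of_subset hV₀]; omega)
  obtain ⟨V₂, hV₂, hV₂c⟩ := exists_subset_card_eq
    (show m ≤ #(((X \ A) \ V₀) \ V₁) by
      rw [card_sdiff_of_subset hV₁, card_sdiff_of_subset hV₀]; omega)
  have h01 : Disjoint V₀ V₁ := disjoint_left.2 fun x hx hx' => (mem_sdiff.1 (hV₁ hx')).2 hx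
  have h12 : Disjoint V₁ V₂ := disjoint_left.2 fun x hx hx' => (mem_sdiff.1 (hV₂ hx')).2 hx
  have h02 : Disjoint V₀ V₂ := disjoint_left.2 fun x hx hx' =>
    (mem_sdiff.1 (mem_sdiff.1 (hV₂ hx')).1).2 hx
  replace hV₁ : V₁ ⊆ X \ A := hV₁.trans sdiff_subset
  replace hV₂ : V₂ ⊆ X \ A := hV₂.trans (sdiff_subset.trans sdiff_subset)
  set P := φ A with hP
  let g : Finset β → Finset β := fun T => φ (A ∪ T) \ (X ∪ P)
  have hgmono : ∀ {S T}, S ⊆ T → g S ⊆ g T := fun h =>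
    sdiff_subset_sdiff (hφ (union_subset_union_right h)) subset_rfl
  have hgX : ∀ T, Disjoint (g T) X := fun T =>
    disjoint_left.2 fun x hx hxX => (mem_sdiff.1 hx).2 (mem_union_left _ hxX)
  have hPX : Disjoint P (X \ A) := disjoint_left.2 fun x hx hx' => by
    have : x ∈ φ A ∩ X := mem_inter.2 ⟨hx, (mem_sdiff.1 hx').1⟩
    rw [hX] at this
    exact (mem_sdiff.1 hx').2 (mem_inter.1 this).1
  have hφg : ∀ T ⊆ X, φ (A ∪ T) = T ∪ (P ∪ g T) := fun T hT => by
    ext x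
    have h1 := Finset.ext_iff.1 (hX (A ∪ T)) x
    have h2 := Finset.ext_iff.1 (hX A) x
    have h3 : x ∈ φ A → x ∈ φ (A ∪ T) := fun h => hφ (subset_union_left (s₂ := T)) h
    have h4 := @hT x
    simp only [g, mem_inter, mem_union, mem_sdiff, hP] at h1 h2 ⊢
    grind
  have hgcard : ∀ T ⊆ X, #T ≤ 5 → #(g T) ≤ 5 := fun T hT hT5 => by
    have h := hcon (A ∪ T) (union_subset hA hT) ((card_union_le _ _).trans (by omega))
    have h1 : φ (A ∪ T) \ X = (P \ X) ∪ g T := by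
      ext x
      have h3 : x ∈ φ A → x ∈ φ (A ∪ T) := fun h => hφ (subset_union_left (s₂ := T)) h
      simp only [g, mem_union, mem_sdiff, hP]
      grind
    have h2 : Disjoint (P \ X) (g T) := disjoint_left.2 fun x hx hx' =>
      (mem_sdiff.1 hx').2 (mem_union_right _ (mem_sdiff.1 hx).1)
    rw [h1, card_union_of_disjoint h2] at h
    omega
  have hfewbad : ∀ V, Disjoint V₀ V → V ⊆ X \ A → m ≤ #V →
      #{b ∈ V₀ | ∃ D : Finset β, #D ≤ 5 ∧ Disjoint D X ∧
        #(blockedPoints c κ (insert b (P ∪ g {b})) D V) ≤ M} < m := by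
    intro V h0V hVX hmV
    by_contra! hbad
    set bad := {b ∈ V₀ | ∃ D : Finset β, #D ≤ 5 ∧ Disjoint D X ∧
        #(blockedPoints c κ (insert b (P ∪ g {b})) D V) ≤ M} with hbaddef
    have hb0 : bad ⊆ V₀ := filter_subset _ _
    have hg : ∀ b, ∃ s : {S : Finset β // #S ≤ 5}, b ∈ bad → (s : Finset β) = g {b} := fun b => by
      by_cases hb : b ∈ bad
      · exact ⟨⟨_, hgcard {b} (singleton_subset_iff.2
          (mem_sdiff.1 (hV₀ (hb0 hb))).1) (by simp)⟩, fun _ => rfl⟩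
      · exact ⟨⟨∅, by simp⟩, fun h => absurd h hb⟩
    have hD : ∀ b, ∃ D : {S : Finset β // #S ≤ 5}, b ∈ bad → Disjoint (D : Finset β) X ∧
        #(blockedPoints c κ (insert b (P ∪ g {b})) D V) ≤ M := fun b => by
      by_cases hb : b ∈ bad
      · obtain ⟨D, h5, h⟩ := (mem_filter.1 hb).2
        exact ⟨⟨D, h5⟩, fun _ => h⟩
      · exact ⟨⟨∅, by simp⟩, fun h => absurd h hb⟩
    choose g' hg' using hg
    choose D hD using hD
    refine hfan ⟨P, bad, V, g', D, h0V.mono_left hb0, fun b hb => ?_, hbad, hmV, fun b hb => ?_⟩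
    · have hsub : bad ∪ V ⊆ X \ A := union_subset (hb0.trans hV₀) hVX
      rw [hg' b hb, disjoint_union_left, disjoint_union_left]
      exact ⟨⟨hPX.mono_right hsub, (hgX _).mono_right (hsub.trans sdiff_subset)⟩,
        (hD b hb).1.mono_right (hsub.trans sdiff_subset)⟩
    · rw [hg' b hb]
      exact (hD b hb).2
  obtain ⟨b, hb, hb1, hb2⟩ : ∃ b ∈ V₀,
      (∀ D : Finset β, #D ≤ 5 → Disjoint D X →
        M ≤ #(blockedPoints c κ (insert b (P ∪ g {b})) D V₁)) ∧
      (∀ D : Finset β, #D ≤ 5 → Disjoint D X →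
        M ≤ #(blockedPoints c κ (insert b (P ∪ g {b})) D V₂)) := by
    by_contra! h
    have b1 := hfewbad V₁ h01 hV₁ hV₁c.ge
    have b2 := hfewbad V₂ h02 hV₂ hV₂c.ge
    have : #V₀ ≤ _ := (card_le_card fun b hb => ?_).trans (card_union_le
      {b ∈ V₀ | ∃ D : Finset β, #D ≤ 5 ∧ Disjoint D X ∧
        #(blockedPoints c κ (insert b (P ∪ g {b})) D V₁) ≤ M}
      {b ∈ V₀ | ∃ D : Finset β, #D ≤ 5 ∧ Disjoint D X ∧
        #(blockedPoints c κ (insert b (P ∪ g {b})) D V₂) ≤ M})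
    · omega
    · simp only [mem_union, mem_filter, hb, true_and]
      by_cases h1 : ∀ D : Finset β, #D ≤ 5 → Disjoint D X →
        M ≤ #(blockedPoints c κ (insert b (P ∪ g {b})) D V₁)
      · obtain ⟨D, hD, hDX, hlt⟩ := h b hb h1
        exact Or.inr ⟨D, hD, hDX, hlt.le⟩
      · push Not at h1
        obtain ⟨D, hD, hDX, hlt⟩ := h1
        exact Or.inl ⟨D, hD, hDX, hlt.le⟩
  have hbX : b ∈ X := (mem_sdiff.1 (hV₀ hb)).1
  set Q := insert b (P ∪ g {b}) with hQ
  let h : Finset β → Finset β := fun T => g (insert b T)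
  have hhmono : ∀ {S T}, S ⊆ T → h S ⊆ h T := fun hST => hgmono (insert_subset_insert _ hST)
  have hhcard : ∀ T ⊆ X, #T ≤ 4 → #(h T) ≤ 5 := fun T hT hT4 =>
    hgcard _ (insert_subset hbX hT) ((card_insert_le _ _).trans (by omega))
  have hφh : ∀ T ⊆ X, c (T ∪ (Q ∪ h T)) = κ := fun T hT => by
    have : T ∪ (Q ∪ h T) = φ (A ∪ insert b T) := by
      rw [hφg _ (insert_subset hbX hT)]
      have := hgmono (S := {b}) (T := insert b T) (by simp)
      ext x
      have := @this x
      simp only [hQ, h, mem_union, mem_insert]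
      clear * - this
      tauto
    rw [this, hc]
  have hround : ∀ T ⊆ V₁ ∪ V₂, #T ≤ 2 →
      ∃ x ∈ V₁, ∃ x' ∈ V₂, #(h T) + 3 ≤ #(h (insert x (insert x' T))) := by
    intro T hT hT2
    have hVX : V₁ ∪ V₂ ⊆ X := (union_subset hV₁ hV₂).trans sdiff_subset
    have hg : ∀ x, ∃ s : {S : Finset β // #S ≤ 5}, x ∈ V₁ ∪ V₂ → (s : Finset β) = h {x} :=
      fun x => by
      by_cases hx : x ∈ V₁ ∪ V₂
      · exact ⟨⟨_, hhcard {x} (singleton_subset_iff.2 (hVX hx)) (by simp)⟩, fun _ => rfl⟩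
      · exact ⟨⟨∅, by simp⟩, fun h => absurd h hx⟩
    choose g' hg' using hg
    by_contra! hno
    refine hpairs ⟨Q, V₁, V₂, g', ⟨h T, hhcard T (hT.trans hVX) (by omega)⟩, h12,
      ?_, ?_, ?_, ?_, ?_⟩
    · rw [hQ, disjoint_union_left, disjoint_insert_left, disjoint_union_left]
      refine ⟨⟨?_, hPX.mono_right (union_subset hV₁ hV₂), (hgX _).mono_right hVX⟩,
        (hgX _).mono_right hVX⟩
      rw [mem_union, not_or]
      exact ⟨disjoint_left.1 h01 hb, disjoint_left.1 h02 hb⟩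
    · intro x hx
      rw [hg' x hx]
      exact (hgX _).mono_right hVX
    · exact hb1 _ (hhcard T (hT.trans hVX) (by omega)) (hgX _)
    · intro x hx
      have hxV : x ∈ V₁ ∪ V₂ := mem_union_left _ hx
      rw [hg' x hxV]
      have hsub : h T ∪ h {x} ⊆ h (insert x T) :=
        union_subset (hhmono (subset_insert _ _)) (hhmono (by simp))
      exact hb2 _ ((card_le_card hsub).trans (hhcard _ (insert_subset (hVX hxV) (hT.trans hVX))
        ((card_insert_le _ _).trans (by omega)))) ((hgX _).mono_left hsub)
    · intro x hx x' hx'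
      simp only [blockedPoints, mem_filter] at hx hx'
      obtain ⟨hx1, hx⟩ := hx
      obtain ⟨hx2, hx'⟩ := hx'
      have hxV : x ∈ V₁ ∪ V₂ := mem_union_left _ hx1
      have hxV' : x' ∈ V₁ ∪ V₂ := mem_union_right _ hx2
      rw [hg' x hxV] at hx' ⊢
      rw [hg' x' hxV']
      have e1 : ¬ h {x} ⊆ h T := fun hs => hx _ (mem_powerset.2 hs) <| by
        simpa using hφh {x} (singleton_subset_iff.2 (hVX hxV))
      have e2 : ¬ h {x'} ⊆ h T ∪ h {x} := fun hs => hx' _ (mem_powerset.2 hs) <| by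
        simpa using hφh {x'} (singleton_subset_iff.2 (hVX hxV'))
      have e3 : h {x, x'} ⊆ h {x} ∪ h {x'} ∪ h T := by
        by_contra e3
        have := card_add_three_le e1 e2 e3 (w := h (insert x (insert x' T)))
          (hhmono fun y hy => by simp [hy]) (hhmono (by simp)) (hhmono (by simp))
          (hhmono (by simp [insert_subset_iff]))
        exact absurd (hno x hx1 x' hx2) (by omega)
      refine ⟨h {x, x'} ∩ h T, mem_powerset.2 inter_subset_right, ?_⟩
      have e4 : h {x} ⊆ h {x, x'} := hhmono (by simp)
      have e5 : h {x'} ⊆ h {x, x'} := hhmono (by simp)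
      rw [← hφh {x, x'} (insert_subset (hVX hxV) (singleton_subset_iff.2 (hVX hxV')))]
      congr 1
      ext y
      have e3 := @e3 y
      have e4 := @e4 y
      have e5 := @e5 y
      simp only [mem_insert, mem_union, mem_inter, mem_singleton] at e3 ⊢
      clear * - e3 e4 e5
      tauto
  have hVX : V₁ ∪ V₂ ⊆ X := (union_subset hV₁ hV₂).trans sdiff_subset
  obtain ⟨x, hx, x', hx', h1⟩ := hround ∅ (empty_subset _) (by simp)
  have hxx : insert x (insert x' ∅) ⊆ V₁ ∪ V₂ := by simp [insert_subset_iff, hx, hx']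
  have hxxc : #(insert x (insert x' (∅ : Finset β))) ≤ 2 :=
    (card_insert_le _ _).trans (by simp)
  obtain ⟨z, hz, z', hz', h2⟩ := hround _ hxx hxxc
  have hle := hhcard (insert z (insert z' (insert x (insert x' ∅))))
    (insert_subset (hVX (mem_union_left _ hz)) (insert_subset (hVX (mem_union_right _ hz'))
      (hxx.trans hVX)))
    ((card_insert_le _ _).trans ((Nat.add_le_add_right (card_insert_le _ _) 1).trans (by omega)))
  omega

lemma le_card_of_typical [Fintype β] {n : ℕ} {c : Finset β → Bool} {κ : Bool} {m M : ℕ}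
    (hfan : ¬ HasSparseFan c κ m M) (hpairs : ¬ HasUnblockedPairs c κ M)
    (e : Finset (Fin n) ↪o Finset β) (he : ∀ A, c (e A) = κ) {j : ℕ} (hj : 5 * j + 4 * m ≤ n) :
    n + 6 * j ≤ Fintype.card β := by
  obtain ⟨X, φ, hXn, hφ, hX, hr⟩ := exists_monotone_section e
  have hc : ∀ T, c (φ T) = κ := fun T => by
    obtain ⟨A, hA⟩ := hr T
    rw [← hA, he]
  have hgrow : ∀ i ≤ j, ∃ A ⊆ X, #A ≤ 5 * i ∧ 6 * i ≤ #(φ A \ X) := by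
    intro i
    induction i with
    | zero => exact fun _ => ⟨∅, by simp⟩
    | succ i ih =>
      intro hi
      obtain ⟨A, hA, hAc, hAφ⟩ := ih (by omega)
      have hm : 4 * m ≤ #(X \ A) := by
        rw [card_sdiff_of_subset hA]
        omega
      obtain ⟨T, hT, hTc, hTφ⟩ := exists_growing_step hfan hpairs hφ hX hc hA hm
      exact ⟨T, hT, by omega, by omega⟩
  obtain ⟨A, -, -, hA⟩ := hgrow j le_rfl
  calc n + 6 * j ≤ #X + #(φ A \ X) := by omega
    _ = #(X ∪ (φ A \ X)) := (card_union_of_disjoint disjoint_sdiff).symm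
    _ ≤ Fintype.card β := card_le_univ _

end Copies

section Parameters

/-- A number below `exp (-4)`, written as a product of the shape of a union bound. -/
lemma union_bound_lt {y θ δ : ℝ} {N K L : ℕ} (hθ0 : 0 ≤ θ) (hθ : θ ≤ 1 - δ)
    (hN : (N : ℝ) + 1 ≤ Real.exp (16 * y)) (h : 3 * N + K * (16 * y) + 4 ≤ δ * L) :
    ((2 ^ (3 * N) * (N + 1) ^ K : ℕ) : ℝ) * θ ^ L < 1 / 4 := by
  have h2 : (2 : ℝ) ≤ Real.exp 1 := by linarith [Real.add_one_le_exp (1 : ℝ)]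
  have hθ' : θ ≤ Real.exp (-δ) := hθ.trans (by linarith [Real.add_one_le_exp (-δ)])
  have h4 : 5 ≤ Real.exp 4 := by linarith [Real.add_one_le_exp (4 : ℝ)]
  push_cast
  calc (2 : ℝ) ^ (3 * N) * ((N : ℝ) + 1) ^ K * θ ^ L
      ≤ Real.exp 1 ^ (3 * N) * Real.exp (16 * y) ^ K * Real.exp (-δ) ^ L := by gcongr
    _ = Real.exp (3 * N + K * (16 * y) - δ * L) := by
        rw [← Real.exp_nat_mul, ← Real.exp_nat_mul, ← Real.exp_nat_mul, ← Real.exp_add,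
          ← Real.exp_add]
        push_cast
        ring_nf
    _ ≤ Real.exp (-4) := Real.exp_le_exp.2 (by linarith)
    _ < 1 / 4 := by
        rw [Real.exp_neg, inv_eq_one_div]
        exact one_div_lt_one_div_of_lt (by norm_num) (by linarith)

lemma mul_pow_le_pow {y : ℝ} (hy : 2 ^ 60 ≤ y) {i j : ℕ} (hij : j = i + 1 := by norm_num) :
    2 ^ 60 * y ^ i ≤ y ^ j := by
  subst hij
  rw [pow_succ' y]
  exact mul_le_mul_of_nonneg_right hy (pow_nonneg (by linarith) i)

lemma union_bounds_lt {n N m M : ℕ} {y : ℝ} (hy : 2 ^ 60 ≤ y) (hn : (n : ℝ) = y ^ 8)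
    (hN : N ≤ 3 * n) (hm : (n : ℝ) ≤ 80 * m) (hM : (M : ℝ) ≤ y ^ 6) (hM' : y ^ 6 ≤ 2 * M) :
    ((2 ^ (3 * N) * (N + 1) ^ ((10 + M) * N) : ℕ) : ℝ) *
        (1 - (1 / 2 : ℝ) ^ 32) ^ (m * (m - M)) < 1 / 4 ∧
      ((2 ^ (3 * N) * (N + 1) ^ (5 * N + 5) : ℕ) : ℝ) *
        (1 - (1 / 2 : ℝ) ^ 32) ^ (M * M) < 1 / 4 := by
  have hN' : (N : ℝ) ≤ 3 * y ^ 8 := by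
    rw [← hn]
    exact_mod_cast hN
  have hyp : 0 < y := by linarith
  have hexp : (N : ℝ) + 1 ≤ Real.exp (16 * y) := by
    have e1 : y ≤ Real.exp y := by linarith [Real.add_one_le_exp y]
    have e2 : 4 ≤ Real.exp y := by linarith
    calc (N : ℝ) + 1 ≤ 4 * y ^ 8 := by linarith [one_le_pow₀ (n := 8) (show 1 ≤ y by linarith)]
      _ ≤ Real.exp y * Real.exp y ^ 8 := by gcongr
      _ = Real.exp (9 * y) := by
        rw [← pow_succ', ← Real.exp_nat_mul]
        norm_num
      _ ≤ Real.exp (16 * y) := Real.exp_le_exp.2 (by linarith)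
  have hMm : (M : ℝ) ≤ y ^ 8 / 160 := by
    linarith [mul_pow_le_pow hy (i := 6) (j := 7), mul_pow_le_pow hy (i := 7) (j := 8),
      pow_pos hyp 6, pow_pos hyp 7]
  have hm' : y ^ 8 / 80 ≤ m := by linarith
  have hMm' : M ≤ m := by
    have : (M : ℝ) ≤ m := by linarith [pow_pos hyp 8]
    exact_mod_cast this
  constructor
  · refine union_bound_lt (by norm_num) le_rfl hexp ?_
    push_cast [hMm']
    have hlow : y ^ 16 / 12800 ≤ m * ((m : ℝ) - M) :=
      calc y ^ 16 / 12800 = y ^ 8 / 80 * (y ^ 8 / 160) := by ring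
        _ ≤ m * ((m : ℝ) - M) := by
          gcongr
          linarith
    have hup : ((10 : ℝ) + M) * N * (16 * y) ≤ (2 * y ^ 6) * (3 * y ^ 8) * (16 * y) := by
      gcongr
      linarith [mul_pow_le_pow hy (i := 5) (j := 6), one_le_pow₀ (n := 5) (show 1 ≤ y by linarith)]
    have h15 : 2 ^ 60 * y ^ 15 ≤ y ^ 16 := mul_pow_le_pow hy
    have h8 : y ^ 8 ≤ y ^ 15 := pow_le_pow_right₀ (by linarith) (by norm_num)
    have h8' : 1 ≤ y ^ 15 := one_le_pow₀ (by linarith)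
    ring_nf at hup hlow ⊢
    linarith
  · refine union_bound_lt (by norm_num) le_rfl hexp ?_
    push_cast
    have hlow : y ^ 12 / 4 ≤ (M : ℝ) * M :=
      calc y ^ 12 / 4 = y ^ 6 / 2 * (y ^ 6 / 2) := by ring
        _ ≤ (M : ℝ) * M := by
          gcongr <;> linarith
    have hup : ((5 : ℝ) * N + 5) * (16 * y) ≤ (20 * y ^ 8) * (16 * y) := by
      gcongr
      linarith [one_le_pow₀ (n := 8) (show 1 ≤ y by linarith)]
    have h11 : 2 ^ 60 * y ^ 11 ≤ y ^ 12 := mul_pow_le_pow hy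
    have h8 : y ^ 8 ≤ y ^ 11 := pow_le_pow_right₀ (by linarith) (by norm_num)
    have h9 : y ^ 9 ≤ y ^ 11 := pow_le_pow_right₀ (by linarith) (by norm_num)
    have h8' : 1 ≤ y ^ 11 := one_le_pow₀ (by linarith)
    ring_nf at hup hlow ⊢
    linarith

end Parameters

section RamseyNumber

/-- The poset Ramsey number is well defined. -/
lemma exists_monochromatic_copy (n : ℕ) : ∃ N : ℕ, ∀ c : Finset (Fin N) → Bool,
    (∃ e : Finset (Fin n) ↪o Finset (Fin N), ∀ p, c (e p) = true) ∨
    (∃ e : Finset (Fin n) ↪o Finset (Fin N), ∀ q, c (e q) = false) := by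
  classical
  let γ := Fin n ⊕ Fin (n + 1) × Fin n
  let E : Finset γ ↪o Finset (Fin (Fintype.card γ)) :=
    mapEmbedding (Fintype.equivFin γ).toEmbedding
  refine ⟨Fintype.card γ, fun c => ?_⟩
  let f : Finset (Fin n) → Finset (Fin n) → Finset γ := fun A S =>
    A.disjSum {x | x.1 < #A ∨ x.1 = #A ∧ x.2 ∈ S}
  have hfl : ∀ {A A' S S'}, f A S ⊆ f A' S' → A ⊆ A' := fun h i hi =>
    inl_mem_disjSum.1 (h (inl_mem_disjSum.2 hi))
  have hfr : ∀ {A S S'}, f A S ⊆ f A S' ↔ S ⊆ S' := fun {A S S'} => by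
    constructor
    · intro h i hi
      have hA : #A < n + 1 := Nat.lt_succ_of_le (card_finset_fin_le A)
      have : Sum.inr (⟨#A, hA⟩, i) ∈ f A S' := h <|
        inr_mem_disjSum.2 (by simp [hi])
      simpa using inr_mem_disjSum.1 this
    · exact fun h => disjSum_mono_right _ (monotone_filter_right _ fun x _ hx =>
        hx.imp_right fun hx => ⟨hx.1, h hx.2⟩)
  by_cases hblue : ∀ A, ∃ S, c (E (f A S)) = true
  · choose S hS using hblue
    refine Or.inl ⟨(OrderEmbedding.ofMapLEIff (fun A => f A (S A))
      fun A A' => ⟨hfl, fun h => ?_⟩).trans E, hS⟩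
    obtain rfl | h := eq_or_ssubset_of_subset h
    · exact le_rfl
    · exact disjSum_mono h.1 (monotone_filter_right _ fun x _ hx =>
        Or.inl (by have := card_lt_card h; omega))
  · push Not at hblue
    obtain ⟨A, hA⟩ := hblue
    exact Or.inr ⟨(OrderEmbedding.ofMapLEIff (f A) fun _ _ => hfr).trans E,
      fun S => by simpa using hA S⟩

open Classical in
lemma exists_typical_coloring {β : Type*} [Fintype β] [DecidableEq β] {m M : ℕ}
    (hfan : ((2 ^ (3 * Fintype.card β) * (Fintype.card β + 1) ^ ((10 + M) * Fintype.card β) : ℕ) :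
      ℝ) * (1 - (1 / 2 : ℝ) ^ 32) ^ (m * (m - M)) < 1 / 4)
    (hpairs : ((2 ^ (3 * Fintype.card β) * (Fintype.card β + 1) ^ (5 * Fintype.card β + 5) : ℕ) :
      ℝ) * (1 - (1 / 2 : ℝ) ^ 32) ^ (M * M) < 1 / 4) :
    ∃ c : Finset β → Bool, ∀ κ, ¬ HasSparseFan c κ m M ∧ ¬ HasUnblockedPairs c κ M := by
  by_contra! h
  have hcover : (univ : Finset (Finset β → Bool)) ⊆
      univ.biUnion fun κ =>
        univ.filter (fun c => HasSparseFan c κ m M) ∪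
          univ.filter fun c => HasUnblockedPairs c κ M := by
    intro c _
    obtain ⟨κ, hκ⟩ := h c
    simp only [mem_biUnion, mem_union, mem_filter, mem_univ, true_and]
    exact ⟨κ, or_iff_not_imp_left.2 hκ⟩
  have hcard := (card_le_card hcover).trans (card_biUnion_le.trans
    (sum_le_sum fun κ _ => card_union_le _ _))
  rw [card_univ, Fintype.card_fun, Fintype.card_bool] at hcard
  have hcard' : (2 : ℝ) ^ Fintype.card (Finset β) ≤
      ∑ κ : Bool, ((#{c : Finset β → Bool | HasSparseFan c κ m M} : ℝ) +
        #{c : Finset β → Bool | HasUnblockedPairs c κ M}) := by exact_mod_cast hcard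
  have hlt : ∀ κ, (#{c : Finset β → Bool | HasSparseFan c κ m M} : ℝ) +
      #{c : Finset β → Bool | HasUnblockedPairs c κ M} <
        1 / 4 * 2 ^ Fintype.card (Finset β) + 1 / 4 * 2 ^ Fintype.card (Finset β) := fun κ => by
    refine add_lt_add ((card_hasSparseFan_le κ).trans_lt ?_)
      ((card_hasUnblockedPairs_le κ).trans_lt ?_)
    · rw [← mul_assoc]
      exact mul_lt_mul_of_pos_right hfan (by positivity)
    · rw [← mul_assoc]
      exact mul_lt_mul_of_pos_right hpairs (by positivity)
  have h1 := hlt true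
  have h2 := hlt false
  rw [Fintype.sum_bool] at hcard'
  linarith

end RamseyNumber

/-- There is `n₀` such that for all `n ≥ n₀`, `R(Q_n, Q_n) > 2.02·n`. -/
theorem diagonal_ramsey_lower :
    ∃ n₀ : ℕ, ∀ n : ℕ, n₀ ≤ n →
      (2.02 : ℝ) * (n : ℝ) < (posetRamsey (Finset (Fin n)) (Finset (Fin n)) : ℝ) := by
  refine ⟨(2 ^ 60) ^ 8, fun n hn => ?_⟩
  by_contra! hle
  set N := posetRamsey (Finset (Fin n)) (Finset (Fin n)) with hN
  have hmono := Nat.sInf_mem (exists_monochromatic_copy n)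
  change ∀ c : Finset (Fin N) → Bool, _ at hmono
  set y : ℝ := (n : ℝ) ^ (1 / 8 : ℝ)
  have hny : (n : ℝ) = y ^ 8 := by
    rw [← Real.rpow_natCast, ← Real.rpow_mul n.cast_nonneg]
    norm_num
  have hy0 : 0 ≤ y := Real.rpow_nonneg n.cast_nonneg _
  have hy : 2 ^ 60 ≤ y := by
    refine le_of_pow_le_pow_left₀ (n := 8) (by norm_num) hy0 ?_
    rw [← hny]
    exact_mod_cast hn
  have hn1 : 10 ^ 6 ≤ n := le_trans (by norm_num) hn
  have hy6 : 1 ≤ y ^ 6 := one_le_pow₀ (by linarith)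
  have hN3 : N ≤ 3 * n := by
    have : (N : ℝ) ≤ 3 * n := by linarith [(n.cast_nonneg : (0 : ℝ) ≤ n)]
    exact_mod_cast this
  obtain ⟨hfan, hpairs⟩ := union_bounds_lt (m := n / 40) (M := ⌊y ^ 6⌋₊) hy hny hN3
    (by exact_mod_cast (by omega : n ≤ 80 * (n / 40))) (Nat.floor_le (by linarith))
    (by
      have := Nat.lt_floor_add_one (y ^ 6)
      have h1 : (1 : ℝ) ≤ ⌊y ^ 6⌋₊ := by exact_mod_cast Nat.le_floor (by exact_mod_cast hy6)
      linarith)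
  obtain ⟨c, hc⟩ := exists_typical_coloring (β := Fin N)
    (by simpa only [Fintype.card_fin] using hfan) (by simpa only [Fintype.card_fin] using hpairs)
  obtain ⟨κ, e, he⟩ : ∃ κ, ∃ e : Finset (Fin n) ↪o Finset (Fin N), ∀ A, c (e A) = κ := by
    obtain h | h := hmono c
    exacts [⟨true, h⟩, ⟨false, h⟩]
  have hcard := le_card_of_typical (hc κ).1 (hc κ).2 e he (j := (n - 4 * (n / 40)) / 5) (by omega)
  rw [Fintype.card_fin] at hcard
  have h100 : 100 * N ≤ 202 * n := by
    have : (100 : ℝ) * N ≤ 202 * n := by linarith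
    exact_mod_cast this
  omega
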